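/- There exists a positive constant C₂ such that |∂Z(x,t)/∂t| ≤ C₂ · (t^{1/(2α)} + ‖x‖_p)^{−2α−4} for all x ∈ ℚ_p⁴ and all t > 0. -/

import Mathlib

open MeasureTheory Real Filter Set

noncomputable section

namespace PadicParabolic

variable (p : ℕ) [Fact p.Prime]

instance : MeasurableSpace ℚ_[p] := borel _
instance : BorelSpace ℚ_[p] := ⟨rfl⟩

/-- The four dimensional vector space over `ℚ_[p]`, with the max-norm
`‖x‖ = max_{1 ≤ i ≤ 4} |x_i|_p`. -/
abbrev V (p : ℕ) [Fact p.Prime] := Fin 4 → ℚ_[p]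

/-- `a` is a quadratic non-residue modulo `p`. -/
def IsQNR (a : ℤ) : Prop := ∀ b : ZMod p, b ^ 2 ≠ (a : ZMod p)

/-- The elliptic quadratic form `f(x) = x₁² − a x₂² − p x₃² + a p x₄²`. -/
def qf (a : ℤ) (x : V p) : ℚ_[p] :=
  x 0 ^ 2 - (a : ℚ_[p]) * x 1 ^ 2 - (p : ℚ_[p]) * x 2 ^ 2 + (a : ℚ_[p]) * (p : ℚ_[p]) * x 3 ^ 2

/-- The dual elliptic quadratic form `f°(ξ) = a p ξ₁² − p ξ₂² − a ξ₃² + ξ₄²`. -/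
def qfc (a : ℤ) (x : V p) : ℚ_[p] :=
  (a : ℚ_[p]) * (p : ℚ_[p]) * x 0 ^ 2 - (p : ℚ_[p]) * x 1 ^ 2 - (a : ℚ_[p]) * x 2 ^ 2 + x 3 ^ 2

/-- `χ` is the standard additive character `χ(y) = exp(2πi {y}_p)` of `ℚ_p`, characterized as
the unique continuous function with `χ(m/pⁿ) = exp(2πi m/pⁿ)`. -/
def IsStdChar (χ : ℚ_[p] → ℂ) : Prop :=
  Continuous χ ∧ ∀ (m : ℤ) (n : ℕ),
    χ ((m : ℚ_[p]) / (p : ℚ_[p]) ^ n) =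
      Complex.exp (2 * (Real.pi : ℂ) * Complex.I * (m : ℂ) / (p : ℂ) ^ n)

/-- The heat kernel `Z(x,t) = ∫_{ℚ_p⁴} χ(ξ·x) e^{−κ t |f°(ξ)|_p^α} d⁴ξ`. -/
def heatZ (μ : Measure (V p)) (χ : ℚ_[p] → ℂ) (a : ℤ) (κ α : ℝ) (x : V p) (t : ℝ) : ℂ :=
  ∫ ξ, χ (∑ i, ξ i * x i) * (Real.exp (-(κ * t * ‖qfc p a ξ‖ ^ α)) : ℂ) ∂μ

variable {p}

theorem norm_intCast_eq_one_of_isQNR {a : ℤ} (ha : IsQNR p a) : ‖(a : ℚ_[p])‖ = 1 := by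
  refine le_antisymm (Padic.norm_int_le_one a) (not_lt.1 fun h => ?_)
  rw [Padic.norm_intCast_lt_one_iff, ← ZMod.intCast_zmod_eq_zero_iff_dvd] at h
  exact ha 0 (by simp [h])

theorem norm_unit_sq_sub {a : ℤ} (ha : IsQNR p a) {w : ℚ_[p]} (hw : ‖w‖ = 1) :
    ‖w ^ 2 - a‖ = 1 := by
  set z : ℤ_[p] := ⟨w, hw.le⟩
  have hz : ‖z ^ 2 - (a : ℤ_[p])‖ = ‖w ^ 2 - (a : ℚ_[p])‖ := by
    rw [PadicInt.norm_def, PadicInt.coe_sub, PadicInt.coe_pow, PadicInt.coe_intCast]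
  rw [← hz]
  refine le_antisymm (PadicInt.norm_le_one _) (not_lt.1 fun h => ?_)
  rw [← PadicInt.mem_nonunits, ← IsLocalRing.mem_maximalIdeal, ← PadicInt.ker_toZMod,
    RingHom.mem_ker, map_sub, map_pow, map_intCast, sub_eq_zero] at h
  exact ha _ h

/-- The binary form `u² − a v²` is anisotropic: its norm is the square of the max-norm. -/
theorem norm_sq_sub_mul_sq {a : ℤ} (ha : IsQNR p a) (u v : ℚ_[p]) :
    ‖u ^ 2 - a * v ^ 2‖ = max ‖u‖ ‖v‖ ^ 2 := by
  have hv : ‖-((a : ℚ_[p]) * v ^ 2)‖ = ‖v‖ ^ 2 := by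
    rw [norm_neg, norm_mul, norm_intCast_eq_one_of_isQNR ha, one_mul, norm_pow]
  by_cases h : ‖u‖ = ‖v‖
  · rw [← h, max_self]
    rcases eq_or_ne v 0 with rfl | hv0
    · simp
    · have hw : ‖u / v‖ = 1 := by rw [norm_div, h, div_self (norm_ne_zero_iff.2 hv0)]
      have : u ^ 2 - a * v ^ 2 = v ^ 2 * ((u / v) ^ 2 - a) := by field_simp
      rw [this, norm_mul, norm_unit_sq_sub ha hw, mul_one, norm_pow, h]
  · have hne : ‖u ^ 2‖ ≠ ‖-((a : ℚ_[p]) * v ^ 2)‖ := by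
      rw [hv, norm_pow]
      exact fun h' => h ((pow_left_inj₀ (norm_nonneg _) (norm_nonneg _) two_ne_zero).1 h')
    rw [sub_eq_add_neg, Padic.add_eq_max_of_ne hne, hv, norm_pow]
    rcases le_total ‖u‖ ‖v‖ with h' | h' <;> simp [h', pow_le_pow_left₀]

theorem norm_p_mul_sq_ne_norm_sq {u v : ℚ_[p]} (hv : v ≠ 0) :
    ‖(p : ℚ_[p])‖ * ‖u‖ ^ 2 ≠ ‖v‖ ^ 2 := by
  have hp : (1 : ℝ) < p := by exact_mod_cast (Fact.out : p.Prime).one_lt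
  intro h
  have hu : u ≠ 0 := by
    rintro rfl
    rw [norm_zero, zero_pow two_ne_zero, mul_zero] at h
    exact hv (norm_eq_zero.1 (pow_eq_zero_iff two_ne_zero |>.1 h.symm))
  rw [Padic.norm_p, Padic.norm_eq_zpow_neg_valuation hu, Padic.norm_eq_zpow_neg_valuation hv,
    ← zpow_neg_one, ← zpow_natCast, ← zpow_natCast, ← zpow_mul, ← zpow_mul,
    ← zpow_add₀ (by positivity)] at h
  have := zpow_right_injective₀ (by positivity) hp.ne' h
  omega

theorem exists_norm_eq_max (u v : ℚ_[p]) : ∃ w : ℚ_[p], ‖w‖ = max ‖u‖ ‖v‖ := by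
  rcases max_choice ‖u‖ ‖v‖ with h | h
  · exact ⟨u, h.symm⟩
  · exact ⟨v, h.symm⟩

theorem norm_qfc {a : ℤ} (ha : IsQNR p a) (ξ : V p) :
    ‖qfc p a ξ‖ =
      max ((p : ℝ)⁻¹ * max ‖ξ 1‖ ‖ξ 0‖ ^ 2) (max ‖ξ 3‖ ‖ξ 2‖ ^ 2) := by
  have h0 : qfc p a ξ =
      -((p : ℚ_[p]) * (ξ 1 ^ 2 - a * ξ 0 ^ 2)) + (ξ 3 ^ 2 - a * ξ 2 ^ 2) := by
    unfold qfc; ring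
  have h1 : ‖-((p : ℚ_[p]) * (ξ 1 ^ 2 - a * ξ 0 ^ 2))‖ =
      (p : ℝ)⁻¹ * max ‖ξ 1‖ ‖ξ 0‖ ^ 2 := by
    rw [norm_neg, norm_mul, norm_sq_sub_mul_sq ha, Padic.norm_p]
  have h2 := norm_sq_sub_mul_sq ha (ξ 3) (ξ 2)
  rw [h0]
  obtain ⟨u, hu⟩ := exists_norm_eq_max (ξ 1) (ξ 0)
  obtain ⟨v, hv⟩ := exists_norm_eq_max (ξ 3) (ξ 2)
  rcases eq_or_ne v 0 with rfl | hv0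
  · rw [norm_zero] at hv
    rw [← hv] at h2 ⊢
    have : ξ 3 ^ 2 - a * ξ 2 ^ 2 = 0 := by simpa using h2
    rw [this, add_zero, h1, zero_pow two_ne_zero, ← hu]
    exact (max_eq_left (by positivity)).symm
  · rw [Padic.add_eq_max_of_ne, h1, h2]
    rw [h1, h2, ← hu, ← hv, ← Padic.norm_p]
    exact norm_p_mul_sq_ne_norm_sq hv0

theorem norm_qfc_le {a : ℤ} (ha : IsQNR p a) (ξ : V p) : ‖qfc p a ξ‖ ≤ ‖ξ‖ ^ 2 := by
  have hp : (1 : ℝ) ≤ p := by exact_mod_cast (Fact.out : p.Prime).one_lt.le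
  have h (i j : Fin 4) : max ‖ξ i‖ ‖ξ j‖ ^ 2 ≤ ‖ξ‖ ^ 2 := by
    gcongr
    exact max_le (norm_le_pi_norm ξ i) (norm_le_pi_norm ξ j)
  rw [norm_qfc ha]
  refine max_le ?_ (h 3 2)
  exact (mul_le_of_le_one_left (by positivity) (inv_le_one_of_one_le₀ hp)).trans (h 1 0)

theorem exists_norm_apply_eq (x : V p) : ∃ i, ‖x i‖ = ‖x‖ := by
  obtain ⟨i, -, hi⟩ := Finset.exists_mem_eq_sup Finset.univ Finset.univ_nonempty fun i => ‖x i‖₊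
  exact ⟨i, by rw [Pi.norm_def, hi, coe_nnnorm]⟩

theorem le_norm_qfc {a : ℤ} (ha : IsQNR p a) (ξ : V p) :
    (p : ℝ)⁻¹ * ‖ξ‖ ^ 2 ≤ ‖qfc p a ξ‖ := by
  have hp : (1 : ℝ) ≤ p := by exact_mod_cast (Fact.out : p.Prime).one_lt.le
  have hp' : (p : ℝ)⁻¹ ≤ 1 := inv_le_one_of_one_le₀ hp
  rw [norm_qfc ha]
  obtain ⟨i, hi⟩ := exists_norm_apply_eq ξ
  rw [← hi]
  have h1 (r s : ℝ) (hr : 0 ≤ r) (h : r ≤ s) : (p : ℝ)⁻¹ * r ^ 2 ≤ (p : ℝ)⁻¹ * s ^ 2 := by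
    gcongr
  have h2 (r s : ℝ) (hr : 0 ≤ r) (h : r ≤ s) : (p : ℝ)⁻¹ * r ^ 2 ≤ s ^ 2 :=
    (mul_le_of_le_one_left (by positivity) hp').trans (by gcongr)
  fin_cases i
  · exact le_max_of_le_left (h1 _ _ (norm_nonneg _) (le_max_right _ _))
  · exact le_max_of_le_left (h1 _ _ (norm_nonneg _) (le_max_left _ _))
  · exact le_max_of_le_right (h2 _ _ (norm_nonneg _) (le_max_right _ _))
  · exact le_max_of_le_right (h2 _ _ (norm_nonneg _) (le_max_left _ _))

/-- The norm of the form is invariant under translations that are small compared to the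
argument. -/
theorem norm_qfc_add {a : ℤ} (ha : IsQNR p a) {ξ η : V p} (h : p * ‖η‖ < ‖ξ‖) :
    ‖qfc p a (ξ + η)‖ = ‖qfc p a ξ‖ := by
  have hp : (1 : ℝ) < p := by exact_mod_cast (Fact.out : p.Prime).one_lt
  have hξ : 0 < ‖ξ‖ := lt_of_le_of_lt (by positivity) h
  have hηξ : ‖η‖ ≤ ‖ξ‖ := by nlinarith [norm_nonneg η]
  have key : ‖qfc p a (ξ + η) - qfc p a ξ‖ ≤ ‖ξ‖ * ‖η‖ := by
    have ha1 := norm_intCast_eq_one_of_isQNR ha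
    have hp1 : ‖(p : ℚ_[p])‖ ≤ 1 := by
      rw [Padic.norm_p]; exact inv_le_one_of_one_le₀ hp.le
    have h2 : ‖(2 : ℚ_[p])‖ ≤ 1 := by exact_mod_cast Padic.norm_int_le_one (p := p) 2
    have hterm (i : Fin 4) (c : ℚ_[p]) (hc : ‖c‖ ≤ 1) :
        ‖c * (2 * ξ i + η i) * η i‖ ≤ ‖ξ‖ * ‖η‖ := by
      have hi := norm_le_pi_norm ξ i
      have hj := norm_le_pi_norm η i
      have h3 : ‖2 * ξ i + η i‖ ≤ ‖ξ‖ := by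
        refine (Padic.nonarchimedean _ _).trans (max_le ?_ (hj.trans hηξ))
        rw [norm_mul]
        exact (mul_le_of_le_one_left (norm_nonneg _) h2).trans hi
      rw [norm_mul, norm_mul]
      exact mul_le_mul ((mul_le_of_le_one_left (norm_nonneg _) hc).trans h3) hj
        (norm_nonneg _) (norm_nonneg _)
    have hexp : qfc p a (ξ + η) - qfc p a ξ =
        ((a * p : ℚ_[p]) * (2 * ξ 0 + η 0) * η 0 + (-p : ℚ_[p]) * (2 * ξ 1 + η 1) * η 1) +
        ((-a : ℚ_[p]) * (2 * ξ 2 + η 2) * η 2 + (1 : ℚ_[p]) * (2 * ξ 3 + η 3) * η 3) := by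
      simp only [qfc, Pi.add_apply]; ring
    rw [hexp]
    refine (Padic.nonarchimedean _ _).trans (max_le ((Padic.nonarchimedean _ _).trans
      (max_le (hterm 0 _ ?_) (hterm 1 _ ?_))) ((Padic.nonarchimedean _ _).trans
      (max_le (hterm 2 _ ?_) (hterm 3 _ ?_))))
    · rw [norm_mul, ha1, one_mul]; exact hp1
    · rw [norm_neg]; exact hp1
    · rw [norm_neg, ha1]
    · simp
  have hlt : ‖qfc p a (ξ + η) - qfc p a ξ‖ < ‖qfc p a ξ‖ := by
    refine key.trans_lt (lt_of_lt_of_le ?_ (le_norm_qfc ha ξ))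
    rw [← div_eq_inv_mul, lt_div_iff₀ (by positivity)]
    nlinarith
  rw [← add_sub_cancel (qfc p a ξ) (qfc p a (ξ + η)), Padic.add_eq_max_of_ne hlt.ne',
    max_eq_left hlt.le]

/-! ### The standard character -/

theorem denseRange_intCast_div_pow :
    DenseRange fun q : ℤ × ℕ => (q.1 : ℚ_[p]) / (p : ℚ_[p]) ^ q.2 := by
  have hp : (1 : ℝ) < p := by exact_mod_cast (Fact.out : p.Prime).one_lt
  have hp0 : (p : ℚ_[p]) ≠ 0 := by exact_mod_cast (Fact.out : p.Prime).ne_zero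
  refine Metric.denseRange_iff.2 fun y r hr => ?_
  obtain ⟨n, hn⟩ := pow_unbounded_of_one_lt ‖y‖ hp
  have hy : ‖(p : ℚ_[p]) ^ n * y‖ ≤ 1 := by
    rw [norm_mul, norm_pow, Padic.norm_p, inv_pow, inv_mul_le_iff₀ (by positivity), mul_one]
    exact hn.le
  obtain ⟨z, hz⟩ : ∃ z : ℤ_[p], (z : ℚ_[p]) = (p : ℚ_[p]) ^ n * y := ⟨⟨_, hy⟩, rfl⟩
  obtain ⟨m, hm⟩ := Metric.denseRange_iff.1 (PadicInt.denseRange_intCast (p := p))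
    z (r / p ^ n) (by positivity)
  refine ⟨(m, n), ?_⟩
  rw [dist_eq_norm, PadicInt.norm_def, PadicInt.coe_sub, PadicInt.coe_intCast, hz] at hm
  have : y - (m : ℚ_[p]) / (p : ℚ_[p]) ^ n =
      ((p : ℚ_[p]) ^ n)⁻¹ * ((p : ℚ_[p]) ^ n * y - m) := by
    field_simp
  rw [dist_eq_norm, this, norm_mul, norm_inv, norm_pow, Padic.norm_p, inv_pow, inv_inv]
  rwa [lt_div_iff₀' (by positivity)] at hm

namespace IsStdChar

variable {χ : ℚ_[p] → ℂ}

theorem norm_eq_one (hχ : IsStdChar p χ) (y : ℚ_[p]) : ‖χ y‖ = 1 := by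
  refine (denseRange_intCast_div_pow (p := p)).induction_on (p := fun y => ‖χ y‖ = 1) y
    (isClosed_eq hχ.1.norm continuous_const) ?_
  rintro ⟨m, n⟩
  have : 2 * (Real.pi : ℂ) * Complex.I * (m : ℂ) / (p : ℂ) ^ n =
      ((2 * Real.pi * m / p ^ n : ℝ) : ℂ) * Complex.I := by
    push_cast; ring
  rw [hχ.2 m n, this, Complex.norm_exp_ofReal_mul_I]

theorem map_add (hχ : IsStdChar p χ) (y z : ℚ_[p]) : χ (y + z) = χ y * χ z := by
  have hp0 : (p : ℚ_[p]) ≠ 0 := by exact_mod_cast (Fact.out : p.Prime).ne_zero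
  have hp1 : (p : ℂ) ≠ 0 := by exact_mod_cast (Fact.out : p.Prime).ne_zero
  refine (denseRange_intCast_div_pow (p := p)).induction_on₂
    (p := fun y z => χ (y + z) = χ y * χ z) ?_ ?_ y z
  · have := hχ.1
    exact isClosed_eq (by fun_prop) (by fun_prop)
  · rintro ⟨m, n⟩ ⟨k, l⟩
    have : (m : ℚ_[p]) / (p : ℚ_[p]) ^ n + (k : ℚ_[p]) / (p : ℚ_[p]) ^ l =
        ((m * p ^ l + k * p ^ n : ℤ) : ℚ_[p]) / (p : ℚ_[p]) ^ (n + l) := by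
      push_cast; field_simp; ring
    rw [this, hχ.2, hχ.2, hχ.2, ← Complex.exp_add]
    congr 1
    push_cast
    field_simp
    ring

theorem map_inv_p_ne_one (hχ : IsStdChar p χ) : χ (p : ℚ_[p])⁻¹ ≠ 1 := by
  have hp : 1 < p := (Fact.out : p.Prime).one_lt
  have hp1 : (p : ℂ) ≠ 0 := by exact_mod_cast (Fact.out : p.Prime).ne_zero
  have h := hχ.2 1 1
  rw [Int.cast_one, pow_one, one_div] at h
  rw [h, Ne, Complex.exp_eq_one_iff]
  rintro ⟨n, hn⟩
  have h2 := Complex.two_pi_I_ne_zero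
  have hn' : (n * p : ℂ) = 1 := by
    rw [Int.cast_one, mul_one, pow_one, div_eq_iff hp1] at hn
    exact mul_right_cancel₀ h2 (by linear_combination -hn)
  have hn' : n * (p : ℤ) = 1 := by exact_mod_cast hn'
  have := Int.eq_one_or_neg_one_of_mul_eq_one' hn'
  omega

end IsStdChar

/-! ### Measures of balls and integrability of the heat kernel -/

section Measure

variable (μ : Measure (V p)) [μ.IsAddHaarMeasure]

open Metric

theorem measure_closedBall_zpow_succ (k : ℤ) :
    μ (closedBall 0 ((p : ℝ) ^ (k + 1))) = p ^ 4 * μ (closedBall 0 ((p : ℝ) ^ k)) := by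
  have hp : (0 : ℝ) < p := by exact_mod_cast (Fact.out : p.Prime).pos
  have hp0 : (p : ℚ_[p]) ≠ 0 := by exact_mod_cast (Fact.out : p.Prime).ne_zero
  set c : ℚ_[p] := (p : ℚ_[p]) ^ (-(k + 1)) with hc
  have hc0 : c ≠ 0 := zpow_ne_zero _ hp0
  have hcn : ‖c‖ = (p : ℝ) ^ (k + 1) := by rw [hc, Padic.norm_p_zpow, neg_neg]
  have hcn' : (p : ℝ) ^ k = ‖c‖ * (p : ℝ) ^ (-1 : ℤ) := by
    rw [hcn, ← zpow_add₀ hp.ne']; congr 1; ring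
  let w (f : Fin 4 → Fin p) : V p := fun i => c * ((f i : ℕ) : ℚ_[p])
  have hmem (f : Fin 4 → Fin p) (ξ : V p) :
      ξ ∈ (fun ξ => -w f + ξ) ⁻¹' closedBall 0 ((p : ℝ) ^ k) ↔
        ∀ i, ‖c⁻¹ * ξ i - ((f i : ℕ) : ℚ_[p])‖ < 1 := by
    rw [mem_preimage, mem_closedBall_zero_iff, pi_norm_le_iff_of_nonneg (by positivity)]
    refine forall_congr' fun i => ?_
    have : (-w f + ξ) i = c * (c⁻¹ * ξ i - ((f i : ℕ) : ℚ_[p])) := by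
      simp only [Pi.add_apply, Pi.neg_apply, w]
      field_simp
      ring
    rw [this, norm_mul, hcn', mul_le_mul_iff_right₀ (norm_pos_iff.2 hc0),
      Padic.norm_le_pow_iff_norm_lt_pow_add_one]
    simp
  have hunion : closedBall 0 ((p : ℝ) ^ (k + 1)) =
      ⋃ f, (fun ξ : V p => -w f + ξ) ⁻¹' closedBall 0 ((p : ℝ) ^ k) := by
    ext ξ
    rw [mem_iUnion]
    simp_rw [hmem]
    rw [mem_closedBall_zero_iff, pi_norm_le_iff_of_nonneg (by positivity), ← hcn]
    have hi (i : Fin 4) : ‖ξ i‖ ≤ ‖c‖ ↔ ‖c⁻¹ * ξ i‖ ≤ 1 := by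
      rw [norm_mul, norm_inv, inv_mul_le_iff₀ (norm_pos_iff.2 hc0), mul_one]
    simp_rw [hi]
    constructor
    · intro h
      have hz (i : Fin 4) : ∃ z : ℤ_[p], (z : ℚ_[p]) = c⁻¹ * ξ i := ⟨⟨_, h i⟩, rfl⟩
      choose z hz using hz
      refine ⟨fun i => ⟨_, PadicInt.zmodRepr_lt_p (z i)⟩, fun i => ?_⟩
      have := PadicInt.norm_sub_zmodRepr_lt_one (z i)
      rwa [PadicInt.norm_def, PadicInt.coe_sub, PadicInt.coe_natCast, hz] at this
    · rintro ⟨f, hf⟩ i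
      rw [← sub_add_cancel (c⁻¹ * ξ i) ((f i : ℕ) : ℚ_[p])]
      refine (Padic.nonarchimedean _ _).trans (max_le (hf i).le ?_)
      exact_mod_cast Padic.norm_int_le_one (p := p) (f i : ℕ)
  have hdisj : Pairwise (Function.onFun Disjoint
      fun f => (fun ξ : V p => -w f + ξ) ⁻¹' closedBall 0 ((p : ℝ) ^ k)) := by
    intro f g hfg
    refine disjoint_left.2 fun ξ hf hg => hfg ?_
    rw [hmem] at hf hg
    ext i
    have h : ‖(((f i : ℕ) - (g i : ℕ) : ℤ) : ℚ_[p])‖ < 1 := by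
      have := (Padic.nonarchimedean (c⁻¹ * ξ i - ((g i : ℕ) : ℚ_[p]))
        (-(c⁻¹ * ξ i - ((f i : ℕ) : ℚ_[p])))).trans_lt
        (max_lt (hg i) (by rw [norm_neg]; exact hf i))
      have heq : (((f i : ℕ) - (g i : ℕ) : ℤ) : ℚ_[p]) =
          c⁻¹ * ξ i - ((g i : ℕ) : ℚ_[p]) + -(c⁻¹ * ξ i - ((f i : ℕ) : ℚ_[p])) := by
        push_cast; ring
      rwa [heq]
    rw [Padic.norm_intCast_lt_one_iff] at h
    have := Int.eq_zero_of_abs_lt_dvd h (by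
      have := (f i).2; have := (g i).2; rw [abs_lt]; constructor <;> omega)
    omega
  rw [hunion, measure_iUnion hdisj fun f =>
    (measurable_const_add _) isClosed_closedBall.measurableSet]
  simp_rw [measure_preimage_add]
  simp [tsum_fintype]

theorem measure_closedBall_zpow (hμ : μ (closedBall 0 1) = 1) (k : ℤ) :
    μ (closedBall 0 ((p : ℝ) ^ k)) = (p : ENNReal) ^ (4 * k) := by
  have hp0 : (p : ENNReal) ≠ 0 := by exact_mod_cast (Fact.out : p.Prime).ne_zero
  have hpt : (p : ENNReal) ≠ ⊤ := ENNReal.natCast_ne_top p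
  have hstep (k : ℤ) : (p : ENNReal) ^ (4 * (k + 1)) = p ^ 4 * (p : ENNReal) ^ (4 * k) := by
    rw [mul_add, ENNReal.zpow_add hp0 hpt, mul_comm]
    rfl
  induction k with
  | zero => simpa using hμ
  | succ k ih => rw [measure_closedBall_zpow_succ, ih, hstep]
  | pred k ih =>
    have h1 := measure_closedBall_zpow_succ μ (-(k : ℤ) - 1)
    have h2 := hstep (-(k : ℤ) - 1)
    rw [sub_add_cancel] at h1 h2
    rw [ih, h2] at h1
    exact ((ENNReal.mul_right_inj (pow_ne_zero 4 hp0) (ENNReal.pow_ne_top hpt)).1 h1).symm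

theorem measure_closedBall_le (hμ : μ (closedBall 0 1) = 1) {r : ℝ} (hr : 0 < r) :
    μ (closedBall 0 r) ≤ ENNReal.ofReal (p ^ 4 * r ^ 4) := by
  have hp : (1 : ℝ) < p := by exact_mod_cast (Fact.out : p.Prime).one_lt
  obtain ⟨k, hk, hk'⟩ := exists_mem_Ico_zpow hr hp
  refine (measure_mono (closedBall_subset_closedBall hk'.le)).trans ?_
  have hz (m : ℤ) : (p : ENNReal) ^ m = ENNReal.ofReal ((p : ℝ) ^ m) := by
    have hp0 : (p : NNReal) ≠ 0 := by exact_mod_cast (Fact.out : p.Prime).ne_zero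
    rw [← NNReal.coe_natCast, ← NNReal.coe_zpow, ENNReal.ofReal_coe_nnreal,
      ENNReal.coe_zpow hp0, ENNReal.coe_natCast]
  rw [measure_closedBall_zpow μ hμ, hz]
  refine ENNReal.ofReal_le_ofReal ?_
  rw [← mul_pow, mul_comm (4 : ℤ), zpow_mul]
  refine pow_le_pow_left₀ (by positivity) ?_ 4
  rw [zpow_add_one₀ (by positivity), mul_comm]
  gcongr

theorem measure_norm_pow_four_le (hμ : μ (closedBall 0 1) = 1) {A : ℝ} (hA : 0 < A) :
    μ {ξ | ‖ξ‖ ^ 4 ≤ A} ≤ ENNReal.ofReal (p ^ 4 * A) := by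
  have h4 : (A ^ (1 / 4 : ℝ)) ^ 4 = A := by
    rw [← rpow_natCast, ← rpow_mul hA.le]
    norm_num
  have := measure_closedBall_le μ hμ (rpow_pos_of_pos hA (1 / 4))
  rw [h4] at this
  refine (measure_mono fun ξ hξ => ?_).trans this
  rw [mem_closedBall_zero_iff]
  refine le_of_pow_le_pow_left₀ four_ne_zero (by positivity) ?_
  rw [h4]
  exact hξ

theorem continuous_qfc (a : ℤ) : Continuous (qfc p a) := by
  unfold qfc
  fun_prop

theorem continuous_exp_neg_norm_qfc (a : ℤ) {α : ℝ} (hα : 0 < α) (c : ℝ) :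
    Continuous fun ξ : V p => rexp (-(c * ‖qfc p a ξ‖ ^ α)) := by
  have := (continuous_qfc (p := p) a).norm.rpow_const fun _ => Or.inr hα.le
  fun_prop

theorem norm_pow_four_le_of_le_exp {a : ℤ} (ha : IsQNR p a) {α c s : ℝ} (hα : 0 < α)
    (hc : 0 < c) (hs : 0 < s) {ξ : V p} (h : s ≤ rexp (-(c * ‖qfc p a ξ‖ ^ α))) :
    ‖ξ‖ ^ 4 ≤ p ^ 2 * ((4 / α / c) ^ (2 / α) * s ^ (-(1 / 2) : ℝ)) := by
  have hp : (0 : ℝ) < p := by exact_mod_cast (Fact.out : p.Prime).pos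
  set N := ‖qfc p a ξ‖ with hN
  have hN0 : 0 ≤ N := norm_nonneg _
  have h1 : ‖ξ‖ ^ 4 ≤ p ^ 2 * N ^ 2 := by
    have h2 := le_norm_qfc ha ξ
    rw [inv_mul_le_iff₀ hp] at h2
    calc ‖ξ‖ ^ 4 = (‖ξ‖ ^ 2) ^ 2 := by ring
      _ ≤ (p * N) ^ 2 := by gcongr
      _ = _ := by ring
  have h2 : N ^ α ≤ 4 / α / c * s⁻¹ ^ (α / 4) := by
    have h3 : c * N ^ α ≤ s⁻¹ ^ (α / 4) / (α / 4) := by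
      refine le_trans ?_ (log_le_rpow_div (inv_nonneg.2 hs.le) (by positivity))
      rw [log_inv, le_neg]
      exact (log_le_iff_le_exp hs).2 h
    rw [← le_div_iff₀' hc] at h3
    refine h3.trans_eq ?_
    field_simp
  refine h1.trans (mul_le_mul_of_nonneg_left ?_ (by positivity))
  calc N ^ 2 = (N ^ α) ^ (2 / α) := by
        rw [← rpow_mul hN0, mul_div_cancel₀ _ hα.ne', rpow_ofNat]
    _ ≤ (4 / α / c * s⁻¹ ^ (α / 4)) ^ (2 / α) := by gcongr
    _ = _ := by
        rw [mul_rpow (by positivity) (by positivity), ← rpow_mul (by positivity),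
          rpow_neg hs.le, inv_rpow hs.le]
        congr 3
        field_simp
        norm_num

theorem exists_integral_exp_le (hμ : μ (closedBall 0 1) = 1) {a : ℤ} (ha : IsQNR p a)
    {α : ℝ} (hα : 0 < α) :
    ∃ C : ℝ, 0 ≤ C ∧ ∀ c : ℝ, 0 < c →
      Integrable (fun ξ : V p => rexp (-(c * ‖qfc p a ξ‖ ^ α))) μ ∧
      ∫ ξ, rexp (-(c * ‖qfc p a ξ‖ ^ α)) ∂μ ≤ C * c ^ (-(2 / α)) := by
  have hp : (0 : ℝ) < p := by exact_mod_cast (Fact.out : p.Prime).pos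
  have hint : IntegrableOn (fun s : ℝ => s ^ (-(1 / 2) : ℝ)) (Ioc 0 1) :=
    (intervalIntegrable_iff_integrableOn_Ioc_of_le zero_le_one).1
      (intervalIntegral.intervalIntegrable_rpow' (by norm_num))
  have hnn : ∀ᵐ s ∂volume.restrict (Ioc (0 : ℝ) 1), 0 ≤ s ^ (-(1 / 2) : ℝ) :=
    (ae_restrict_iff' measurableSet_Ioc).2 (ae_of_all _ fun s hs => rpow_nonneg hs.1.le _)
  set L := ∫ s in Ioc (0 : ℝ) 1, s ^ (-(1 / 2) : ℝ) with hL
  have hL0 : 0 ≤ L := integral_nonneg_of_ae hnn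
  refine ⟨p ^ 4 * p ^ 2 * (4 / α) ^ (2 / α) * L, by positivity, fun c hc => ?_⟩
  set K : ℝ := p ^ 4 * p ^ 2 * (4 / α / c) ^ (2 / α) with hK
  have hK0 : 0 ≤ K := by positivity
  have hcont := continuous_exp_neg_norm_qfc (p := p) a hα c
  have hle : ∫⁻ ξ, ENNReal.ofReal (rexp (-(c * ‖qfc p a ξ‖ ^ α))) ∂μ ≤
      ENNReal.ofReal (K * L) := by
    rw [lintegral_eq_lintegral_meas_le μ (ae_of_all _ fun ξ => (exp_pos _).le)
      hcont.aemeasurable, ← integral_const_mul,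
      ofReal_integral_eq_lintegral_ofReal (hint.const_mul K)
        (hnn.mono fun s hs => mul_nonneg hK0 hs),
      ← lintegral_indicator measurableSet_Ioi, ← lintegral_indicator measurableSet_Ioc]
    refine lintegral_mono fun s => ?_
    by_cases hs : 0 < s
    · rw [indicator_of_mem (mem_Ioi.2 hs)]
      by_cases hs1 : s ≤ 1
      · rw [indicator_of_mem (mem_Ioc.2 ⟨hs, hs1⟩)]
        refine (measure_mono fun ξ hξ => norm_pow_four_le_of_le_exp ha hα hc hs hξ).trans ?_
        refine (measure_norm_pow_four_le μ hμ (by positivity)).trans_eq ?_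
        rw [hK]
        congr 1
        ring
      · have : {ξ : V p | s ≤ rexp (-(c * ‖qfc p a ξ‖ ^ α))} = ∅ := by
          refine eq_empty_of_forall_notMem fun ξ hξ => hs1 (le_trans hξ ?_)
          exact exp_le_one_iff.2 (neg_nonpos.2 (by positivity))
        rw [this, measure_empty]
        exact zero_le
    · rw [indicator_of_notMem (by simpa using hs)]
      exact zero_le
  have hInt : Integrable (fun ξ : V p => rexp (-(c * ‖qfc p a ξ‖ ^ α))) μ := by
    refine ⟨hcont.aestronglyMeasurable, ?_⟩
    rw [hasFiniteIntegral_iff_ofReal (ae_of_all _ fun ξ => (exp_pos _).le)]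
    exact hle.trans_lt ENNReal.ofReal_lt_top
  refine ⟨hInt, ?_⟩
  rw [integral_eq_lintegral_of_nonneg_ae (ae_of_all _ fun ξ => (exp_pos _).le)
    hcont.aestronglyMeasurable]
  refine (ENNReal.toReal_mono ENNReal.ofReal_ne_top hle).trans_eq ?_
  rw [ENNReal.toReal_ofReal (mul_nonneg hK0 hL0), hK, div_rpow (by positivity) hc.le,
    rpow_neg hc.le]
  ring

theorem IsStdChar.integrable_mul (ν : Measure (V p)) {χ : ℚ_[p] → ℂ} (hχ : IsStdChar p χ)
    (x : V p) {g : V p → ℂ} (hg : Integrable g ν) :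
    Integrable (fun ξ => χ (∑ i, ξ i * x i) * g ξ) ν := by
  have hχc := hχ.1
  exact hg.bdd_mul (c := 1) (by fun_prop : Continuous fun ξ : V p =>
    χ (∑ i, ξ i * x i)).aestronglyMeasurable (ae_of_all _ fun ξ => (hχ.norm_eq_one _).le)

/-- An oscillatory integral of a function that is invariant, outside of the ball of radius `R`,
under translation by `η` only sees the values on that ball. -/
theorem norm_integral_mul_norm_sub_one_le {χ : ℚ_[p] → ℂ} (hχ : IsStdChar p χ) {x η : V p}
    {R M : ℝ} (hη : ‖η‖ ≤ R) {h : V p → ℂ} (hi : Integrable h μ)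
    (hinv : ∀ ξ, R < ‖ξ‖ → h (ξ + η) = h ξ) (hM : ∀ ξ, ‖ξ‖ ≤ R → ‖h ξ‖ ≤ M) :
    ‖∫ ξ, χ (∑ i, ξ i * x i) * h ξ ∂μ‖ * ‖χ (∑ i, η i * x i) - 1‖ ≤
      2 * M * μ.real (closedBall 0 R) := by
  have hmul {g : V p → ℂ} := IsStdChar.integrable_mul μ hχ x (g := g)
  have hi' : Integrable (fun ξ => h (ξ + η)) μ := hi.comp_add_right η
  set I := ∫ ξ, χ (∑ i, ξ i * x i) * h ξ ∂μ with hI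
  have h1 : I = χ (∑ i, η i * x i) * ∫ ξ, χ (∑ i, ξ i * x i) * h (ξ + η) ∂μ := by
    rw [hI, ← integral_add_right_eq_self _ η, ← integral_const_mul]
    refine integral_congr_ae (ae_of_all _ fun ξ => ?_)
    simp only [Pi.add_apply, add_mul, Finset.sum_add_distrib, hχ.map_add]
    ring
  have h2 : I * (χ (∑ i, η i * x i) - 1) = χ (∑ i, η i * x i) *
      -∫ ξ, χ (∑ i, ξ i * x i) * (h (ξ + η) - h ξ) ∂μ := by
    simp_rw [mul_sub]
    rw [integral_sub (hmul hi') (hmul hi), ← hI]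
    linear_combination -h1
  rw [← norm_mul, h2, norm_mul, hχ.norm_eq_one, one_mul, norm_neg,
    ← setIntegral_eq_integral_of_forall_compl_eq_zero (s := closedBall 0 R)]
  · refine norm_setIntegral_le_of_norm_le_const measure_closedBall_lt_top fun ξ hξ => ?_
    rw [mem_closedBall_zero_iff] at hξ
    rw [norm_mul, hχ.norm_eq_one, one_mul, two_mul]
    refine (norm_sub_le _ _).trans (add_le_add (hM _ ?_) (hM _ hξ))
    refine (pi_norm_le_iff_of_nonneg ((norm_nonneg _).trans hξ)).2 fun i => ?_
    exact (Padic.nonarchimedean _ _).trans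
      (max_le ((norm_le_pi_norm ξ i).trans hξ) ((norm_le_pi_norm η i).trans hη))
  · intro ξ hξ
    rw [mem_closedBall_zero_iff, not_le] at hξ
    rw [hinv ξ hξ, sub_self, mul_zero]

theorem abs_exp_neg_sub_exp_neg_le {m u v : ℝ} (hu : m ≤ u) (hv : m ≤ v) :
    |rexp (-u) - rexp (-v)| ≤ rexp (-m) * |u - v| := by
  wlog huv : u ≤ v generalizing u v
  · rw [abs_sub_comm, abs_sub_comm u]
    exact this hv hu (le_of_not_ge huv)
  have h1 : rexp (-v) = rexp (-u) * rexp (u - v) := by rw [← exp_add]; congr 1; ring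
  have h2 : 1 - rexp (u - v) ≤ v - u := by linarith [add_one_le_exp (u - v)]
  rw [abs_of_nonneg (sub_nonneg.2 (exp_le_exp.2 (neg_le_neg huv))), abs_of_nonpos (by linarith),
    neg_sub, h1, ← mul_one_sub]
  exact mul_le_mul (exp_le_exp.2 (neg_le_neg hu)) h2
    (sub_nonneg.2 (exp_le_one_iff.2 (by linarith))) (exp_pos _).le

theorem heatZ_sub_heatZ (ν : Measure (V p)) {χ : ℚ_[p] → ℂ} (hχ : IsStdChar p χ)
    {a : ℤ} {κ α : ℝ} (x : V p)
    {s t : ℝ} (hs : Integrable (fun ξ : V p => rexp (-(κ * s * ‖qfc p a ξ‖ ^ α))) ν)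
    (ht : Integrable (fun ξ : V p => rexp (-(κ * t * ‖qfc p a ξ‖ ^ α))) ν) :
    heatZ p ν χ a κ α x s - heatZ p ν χ a κ α x t =
      ∫ ξ, χ (∑ i, ξ i * x i) * ((rexp (-(κ * s * ‖qfc p a ξ‖ ^ α)) -
        rexp (-(κ * t * ‖qfc p a ξ‖ ^ α)) : ℝ) : ℂ) ∂ν := by
  have hs' : Integrable (fun ξ : V p => (rexp (-(κ * s * ‖qfc p a ξ‖ ^ α)) : ℂ)) ν := hs.ofReal
  have ht' : Integrable (fun ξ : V p => (rexp (-(κ * t * ‖qfc p a ξ‖ ^ α)) : ℂ)) ν := ht.ofReal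
  unfold heatZ
  rw [← integral_sub (IsStdChar.integrable_mul ν hχ x hs') (IsStdChar.integrable_mul ν hχ x ht')]
  simp_rw [← mul_sub, Complex.ofReal_sub]

theorem abs_exp_sub_exp_le {a : ℤ} {κ α s t : ℝ} (hκ : 0 < κ) (ht : 0 < t) (hst : t / 2 ≤ s)
    (ξ : V p) :
    |rexp (-(κ * s * ‖qfc p a ξ‖ ^ α)) - rexp (-(κ * t * ‖qfc p a ξ‖ ^ α))| ≤
      rexp (-(κ * (t / 2) * ‖qfc p a ξ‖ ^ α)) * (κ * |s - t| * ‖qfc p a ξ‖ ^ α) := by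
  have hF : 0 ≤ ‖qfc p a ξ‖ ^ α := by positivity
  refine (abs_exp_neg_sub_exp_neg_le (m := κ * (t / 2) * ‖qfc p a ξ‖ ^ α) (by gcongr)
    (by gcongr; linarith)).trans_eq ?_
  rw [← sub_mul, ← mul_sub, abs_mul, abs_mul, abs_of_pos hκ, abs_of_nonneg hF]

/-- The bound on the time derivative that is uniform in space. -/
theorem exists_norm_heatZ_sub_le_time (hμ : μ (closedBall 0 1) = 1) {χ : ℚ_[p] → ℂ}
    (hχ : IsStdChar p χ) {a : ℤ} (ha : IsQNR p a) {κ α : ℝ} (hκ : 0 < κ) (hα : 0 < α) :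
    ∃ C : ℝ, 0 ≤ C ∧ ∀ (x : V p) (s t : ℝ), 0 < t → t / 2 ≤ s →
      ‖heatZ p μ χ a κ α x s - heatZ p μ χ a κ α x t‖ ≤
        C * (t ^ (1 / (2 * α))) ^ (-(2 * α) - 4) * |s - t| := by
  obtain ⟨C, hC, hexp⟩ := exists_integral_exp_le μ hμ ha hα
  refine ⟨4 * C * (κ / 4) ^ (-(2 / α)), by positivity, fun x s t ht hst => ?_⟩
  obtain ⟨hi, hle⟩ := hexp (κ / 4 * t) (by positivity)
  rw [heatZ_sub_heatZ μ hχ x (hexp _ (mul_pos hκ (by linarith))).1 (hexp _ (mul_pos hκ ht)).1]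
  calc _ ≤ ∫ ξ, |s - t| * (4 / t) * rexp (-(κ / 4 * t * ‖qfc p a ξ‖ ^ α)) ∂μ := by
        refine norm_integral_le_of_norm_le (hi.const_mul _) (ae_of_all _ fun ξ => ?_)
        rw [norm_mul, hχ.norm_eq_one, one_mul, Complex.norm_real, norm_eq_abs]
        refine (abs_exp_sub_exp_le hκ ht hst ξ).trans ?_
        set F := ‖qfc p a ξ‖ ^ α
        have hy : κ / 4 * t * F ≤ rexp (κ / 4 * t * F) := by
          linarith [add_one_le_exp (κ / 4 * t * F)]
        have h2 : rexp (-(κ / 4 * t * F)) =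
            rexp (-(κ * (t / 2) * F)) * rexp (κ / 4 * t * F) := by
          rw [← exp_add]; congr 1; ring
        rw [h2]
        calc _ = |s - t| * (4 / t) * (rexp (-(κ * (t / 2) * F)) * (κ / 4 * t * F)) := by
              field_simp
          _ ≤ _ := by gcongr
    _ ≤ |s - t| * (4 / t) * (C * (κ / 4 * t) ^ (-(2 / α))) := by
        rw [integral_const_mul]
        gcongr
    _ = _ := by
        have h3 : (t ^ (1 / (2 * α))) ^ (-(2 * α) - 4) = t⁻¹ * t ^ (-(2 / α)) := by
          rw [← rpow_mul ht.le, ← rpow_neg_one t, ← rpow_add ht]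
          congr 1
          field_simp
          ring
        rw [h3, mul_rpow (by positivity) ht.le]
        field_simp

/-- The bound on the time derivative that is uniform in time. -/
theorem exists_norm_heatZ_sub_le_space (hμ : μ (closedBall 0 1) = 1) {χ : ℚ_[p] → ℂ}
    (hχ : IsStdChar p χ) {a : ℤ} (ha : IsQNR p a) {κ α : ℝ} (hκ : 0 < κ) (hα : 0 < α) :
    ∃ C : ℝ, 0 ≤ C ∧ ∀ (x : V p) (s t : ℝ), x ≠ 0 → 0 < t → t / 2 ≤ s →
      ‖heatZ p μ χ a κ α x s - heatZ p μ χ a κ α x t‖ ≤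
        C * ‖x‖ ^ (-(2 * α) - 4) * |s - t| := by
  have hp : (0 : ℝ) < p := by exact_mod_cast (Fact.out : p.Prime).pos
  have hp1 : (1 : ℝ) < p := by exact_mod_cast (Fact.out : p.Prime).one_lt
  obtain ⟨_, _, hexp⟩ := exists_integral_exp_le μ hμ ha hα
  set δ := ‖χ (p : ℚ_[p])⁻¹ - 1‖ with hδ
  have hδ0 : 0 < δ := norm_pos_iff.2 (sub_ne_zero.2 hχ.map_inv_p_ne_one)
  refine ⟨2 * κ * p ^ 4 * ((p : ℝ) ^ 2) ^ (2 * α + 4) / δ, by positivity,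
    fun x s t hx ht hst => ?_⟩
  have hx0 : 0 < ‖x‖ := norm_pos_iff.2 hx
  have his := (hexp _ (mul_pos hκ (show 0 < s by linarith))).1
  have hit := (hexp _ (mul_pos hκ ht)).1
  obtain ⟨i, hi⟩ := exists_norm_apply_eq x
  have hxi : x i ≠ 0 := norm_ne_zero_iff.1 (hi ▸ hx0.ne')
  set η : V p := Pi.single i ((p : ℚ_[p])⁻¹ * (x i)⁻¹) with hη
  have hηx : ∑ j, η j * x j = (p : ℚ_[p])⁻¹ := by
    rw [Finset.sum_eq_single i (fun j _ hj => by simp [hη, hj]) (by simp), hη, Pi.single_eq_same,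
      mul_assoc, inv_mul_cancel₀ hxi, mul_one]
  have hηn : ‖η‖ = p / ‖x‖ := by
    rw [hη, Pi.norm_single, norm_mul, norm_inv, norm_inv, Padic.norm_p, inv_inv, hi, div_eq_mul_inv]
  set R : ℝ := p ^ 2 / ‖x‖ with hR
  have hR0 : 0 < R := by positivity
  have hpη : p * ‖η‖ = R := by rw [hηn, hR]; ring
  rw [heatZ_sub_heatZ μ hχ x his hit]
  have hi' : Integrable (fun ξ : V p => ((rexp (-(κ * s * ‖qfc p a ξ‖ ^ α)) -
      rexp (-(κ * t * ‖qfc p a ξ‖ ^ α)) : ℝ) : ℂ)) μ := (his.sub hit).ofReal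
  have key := norm_integral_mul_norm_sub_one_le μ hχ (x := x) (η := η) (R := R)
    (M := κ * |s - t| * (R ^ 2) ^ α) (by rw [← hpη]; nlinarith [norm_nonneg η])
    hi' (fun ξ hξ => by
      rw [norm_qfc_add ha (hpη.trans_lt hξ)]) (fun ξ hξ => by
      rw [Complex.norm_real, norm_eq_abs]
      refine (abs_exp_sub_exp_le hκ ht hst ξ).trans ?_
      refine (mul_le_of_le_one_left (by positivity) (exp_le_one_iff.2 ?_)).trans ?_
      · exact neg_nonpos.2 (by positivity)
      · gcongr
        exact (norm_qfc_le ha ξ).trans (by gcongr))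
  have hball : μ.real (closedBall 0 R) ≤ p ^ 4 * R ^ 4 :=
    ENNReal.toReal_le_of_le_ofReal (by positivity) (measure_closedBall_le μ hμ hR0)
  rw [hηx, ← hδ, ← le_div_iff₀ hδ0] at key
  refine key.trans ?_
  calc _ ≤ 2 * (κ * |s - t| * (R ^ 2) ^ α) * (p ^ 4 * R ^ 4) / δ := by gcongr
    _ = 2 * κ * p ^ 4 * R ^ (2 * α + 4) / δ * |s - t| := by
        rw [rpow_add hR0, rpow_mul hR0.le, rpow_ofNat, rpow_ofNat]
        ring
    _ = _ := by
        rw [hR, div_rpow (by positivity) hx0.le, ← neg_add', rpow_neg hx0.le]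
        ring

end Measure

variable (p)

/-- there is `C₂ > 0` with
`|∂Z(x,t)/∂t| ≤ C₂ (t^{1/(2α)} + ‖x‖_p)^{−2α−4}` for all `x ∈ ℚ_p⁴`, `t > 0`. -/
theorem statement6
    (hp : p ≠ 2) (a : ℤ) (ha : IsQNR p a)
    (μ : Measure (V p)) [μ.IsAddHaarMeasure] (hμ : μ {x : V p | ‖x‖ ≤ 1} = 1)
    (χ : ℚ_[p] → ℂ) (hχ : IsStdChar p χ)
    (κ α : ℝ) (hκ : 0 < κ) (hα : 0 < α) :
    ∃ C₂ : ℝ, 0 < C₂ ∧ ∀ (x : V p) (t : ℝ), 0 < t →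
      ‖deriv (fun s => heatZ p μ χ a κ α x s) t‖ ≤
        C₂ * (t ^ (1 / (2 * α)) + ‖x‖) ^ (-(2 * α) - 4) := by
  have hμ' : μ (Metric.closedBall 0 1) = 1 := by
    rw [← hμ]
    congr 1
    ext x
    simp
  obtain ⟨A, hA, hA'⟩ := exists_norm_heatZ_sub_le_time μ hμ' hχ ha hκ hα
  obtain ⟨B, hB, hB'⟩ := exists_norm_heatZ_sub_le_space μ hμ' hχ ha hκ hα
  have hb : -(2 * α) - 4 ≤ 0 := by linarith
  refine ⟨(A + B + 1) / 2 ^ (-(2 * α) - 4), by positivity, fun x t ht => ?_⟩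
  have hev : ∀ᶠ s in nhds t, t / 2 ≤ s := eventually_ge_nhds (by linarith)
  have hT : 0 < t ^ (1 / (2 * α)) := by positivity
  have hcomb (r c : ℝ) (hr : 0 < r) (hc : c ≤ A + B + 1) (h : t ^ (1 / (2 * α)) + ‖x‖ ≤ 2 * r) :
      c * r ^ (-(2 * α) - 4) ≤
        (A + B + 1) / 2 ^ (-(2 * α) - 4) * (t ^ (1 / (2 * α)) + ‖x‖) ^ (-(2 * α) - 4) := by
    have h1 := rpow_le_rpow_of_nonpos (by positivity) h hb
    rw [mul_rpow two_pos.le hr.le] at h1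
    rw [div_mul_eq_mul_div, mul_div_assoc]
    refine mul_le_mul hc ?_ (by positivity) (by positivity)
    rwa [le_div_iff₀' (by positivity)]
  rcases le_or_gt ‖x‖ (t ^ (1 / (2 * α))) with h | h
  · refine (norm_deriv_le_of_lip' (by positivity) (hev.mono fun s hs => hA' x s t ht hs)).trans ?_
    exact hcomb _ _ hT (by linarith) (by linarith)
  · have hx : 0 < ‖x‖ := hT.trans h
    refine (norm_deriv_le_of_lip' (by positivity)
      (hev.mono fun s hs => hB' x s t (norm_pos_iff.1 hx) ht hs)).trans ?_
    exact hcomb _ _ hx (by linarith) (by linarith)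

end PadicParabolic
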